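/- If G is a finite cubic graph with a Hamiltonian cycle, then some vertex of G is contained in at least three distinct Hamiltonian cycles of G; in particular some edge of G lies on at least two Hamiltonian cycles. -/

import Mathlib

open SimpleGraph

/-- The edge sets of Hamiltonian cycles of a graph `G`. -/
def HamSets {V : Type*} [Fintype V] [DecidableEq V] (G : SimpleGraph V) :
    Set (Set (Sym2 V)) :=
  {E | ∃ (v : V) (w : G.Walk v v), w.IsHamiltonianCycle ∧ E = {e | e ∈ w.edges}}

/-- A Hamiltonian path of `G` starting with the edge from `v` to `w`, given as the list of its
vertices after `v`. -/
structure IsHamArc {V : Type*} (G : SimpleGraph V) (v w : V) (m : List V) : Prop where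
  head : m.head? = some w
  nodup : (v :: m).Nodup
  mem : ∀ y, y ∈ v :: m
  chain : (v :: m).IsChain G.Adj

/-- The path `m` may be rotated at its vertex `x`: the part of `m` after `x` has at least two
vertices and its end is adjacent to `x`. -/
def IsPivot {V : Type*} (G : SimpleGraph V) (m : List V) (x : V) : Prop :=
  ∃ a t : List V, m = a ++ x :: t ∧ 2 ≤ t.length ∧ ∀ d ∈ t.getLast?, G.Adj x d

/-- Reverse the part of a list after the first occurrence of `x`. -/
def reverseAfter {V : Type*} [DecidableEq V] (m : List V) (x : V) : List V :=
  m.takeWhile (· ≠ x) ++ x :: (m.dropWhile (· ≠ x)).tail.reverse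

section

variable {V : Type*} {G : SimpleGraph V} {v w : V}

lemma reverseAfter_append_cons [DecidableEq V] {a t : List V} {x : V} (h : x ∉ a) :
    reverseAfter (a ++ x :: t) x = a ++ x :: t.reverse := by
  have h' : ∀ y ∈ a, decide (y ≠ x) = true := by
    intro y hy
    simp only [decide_eq_true_eq]
    rintro rfl
    exact h hy
  simp only [reverseAfter, List.takeWhile_append_of_pos h', List.dropWhile_append_of_pos h']
  simp

lemma IsHamArc.reverse_suffix {a t : List V} {x : V} (h : IsHamArc G v w (a ++ x :: t))
    (hx : ∀ d ∈ t.getLast?, G.Adj x d) : IsHamArc G v w (a ++ x :: t.reverse) where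
  head := by have := h.head; cases a <;> simpa using this
  nodup := by
    have := h.nodup
    refine (List.Perm.nodup_iff ?_).1 this
    exact ((((List.reverse_perm t).symm).cons x).append_left a).cons v
  mem y := by simpa using h.mem y
  chain := by
    have e : ∀ s, v :: (a ++ x :: s) = (v :: a ++ [x]) ++ s := by simp
    have := h.chain
    rw [e, List.isChain_append] at this ⊢
    obtain ⟨h1, h2, -⟩ := this
    refine ⟨h1, ?_, ?_⟩
    · rw [List.isChain_reverse]
      exact h2.imp fun _ _ h => h.symm
    · intro y hy z hz
      simp only [List.getLast?_append, List.getLast?_singleton, Option.mem_def, Option.some_or,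
        Option.some.injEq] at hy
      subst hy
      exact hx z (by simpa using hz)

lemma IsHamArc.reverseAfter_spec [DecidableEq V] {m : List V} {x : V} (h : IsHamArc G v w m)
    (hx : IsPivot G m x) :
    IsHamArc G v w (reverseAfter m x) ∧ IsPivot G (reverseAfter m x) x ∧
      reverseAfter m x ≠ m ∧ reverseAfter (reverseAfter m x) x = m := by
  obtain ⟨a, t, rfl, ht, hd⟩ := hx
  have hn := h.nodup
  have hxa : x ∉ a := by
    intro hxa
    simp [List.nodup_append] at hn
    grind
  rw [reverseAfter_append_cons hxa, reverseAfter_append_cons hxa, List.reverse_reverse]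
  refine ⟨h.reverse_suffix hd, ⟨a, _, rfl, by simpa using ht, ?_⟩, ?_, rfl⟩
  · intro d hd'
    have hc := h.chain
    rw [show v :: (a ++ x :: t) = (v :: a ++ [x]) ++ t by simp, List.isChain_append] at hc
    exact hc.2.2 x (by rw [List.getLast?_concat]; rfl) d (by simpa using hd')
  · intro he
    have he : t.reverse = t := by simpa using he
    have htn : t.Nodup := by
      simp [List.nodup_append] at hn
      tauto
    match t, ht with
    | c :: d :: s, _ =>
      have h1 : (c :: d :: s).reverse.head? = some c := by rw [he]; rfl
      rw [List.head?_reverse] at h1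
      have : c ∈ d :: s := List.mem_of_getLast? (by simpa using h1)
      exact (List.nodup_cons.1 htn).1 this

lemma IsHamArc.length_add_one [Fintype V] {m : List V} (h : IsHamArc G v w m) :
    m.length + 1 = Fintype.card V := by
  classical
  rw [← List.length_cons (a := v), ← List.toFinset_card_of_nodup h.nodup, ← Finset.card_univ]
  congr 1
  ext y
  simpa using h.mem y

lemma IsHamArc.isPivot_iff {m : List V} {p u x : V}
    (h : IsHamArc G v w (m ++ [p, u])) :
    IsPivot G (m ++ [p, u]) x ↔ G.Adj u x ∧ x ≠ p ∧ x ≠ v := by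
  have hn := h.nodup
  constructor
  · rintro ⟨a, t, e, ht, hd⟩
    obtain ⟨t, d, rfl⟩ : ∃ t' d, t = t' ++ [d] :=
      ⟨_, _, (List.dropLast_append_getLast (by rintro rfl; simp at ht)).symm⟩
    obtain ⟨t, c, rfl⟩ : ∃ t' d, t = t' ++ [d] :=
      ⟨_, _, (List.dropLast_append_getLast (by rintro rfl; simp at ht)).symm⟩
    have e' : (m ++ [p]) ++ [u] = (a ++ x :: t ++ [c]) ++ [d] := by simpa using e
    obtain ⟨e1, e2⟩ := List.append_inj' e' rfl
    obtain ⟨e3, e4⟩ := List.append_inj' e1 rfl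
    simp only [List.cons.injEq, and_true] at e2 e4
    subst e2 e4 e3
    refine ⟨(hd u (by simp)).symm, ?_, ?_⟩ <;> rintro rfl <;> simp [List.nodup_append] at hn
  · rintro ⟨hux, hxp, hxv⟩
    have hxm : x ∈ m := by
      have := h.mem x
      have := hux.ne
      simp at *
      grind
    obtain ⟨a, t, rfl⟩ := List.append_of_mem hxm
    exact ⟨a, t ++ [p, u], by simp, by simp, by simpa using hux.symm⟩

lemma IsHamArc.exists_eq_append [Fintype V] {m : List V} (h : IsHamArc G v w m)
    (hV : 4 ≤ Fintype.card V) : ∃ m' p u, m = m' ++ [p, u] ∧ G.Adj u p ∧ p ≠ v := by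
  have hl := h.length_add_one
  obtain ⟨t, u, rfl⟩ : ∃ t' d, m = t' ++ [d] :=
      ⟨_, _, (List.dropLast_append_getLast (by rintro rfl; simp at hl; omega)).symm⟩
  obtain ⟨t, p, rfl⟩ : ∃ t' d, t = t' ++ [d] :=
      ⟨_, _, (List.dropLast_append_getLast (by rintro rfl; simp at hl; omega)).symm⟩
  have hn := h.nodup
  have hc := h.chain
  refine ⟨t, p, u, by simp, ?_, ?_⟩
  · rw [show v :: (t ++ [p] ++ [u]) = (v :: t ++ [p]) ++ [u] by simp, List.isChain_append] at hc
    exact (hc.2.2 p (by rw [List.getLast?_concat]; rfl) u (by simp)).symm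
  · rintro rfl; simp at hn

lemma finite_isHamArc [Fintype V] : {m | IsHamArc G v w m}.Finite :=
  (List.finite_length_le V (Fintype.card V)).subset fun m hm => by
    have := hm.length_add_one
    simp only [Set.mem_ofPred_eq]
    omega

open Classical in
lemma IsHamArc.card_isPivot [Fintype V] {m : List V} (h : IsHamArc G v w m)
    (hcubic : ∀ v : V, G.degree v = 3) :
    ((∑ x : V, if IsPivot G m x then 1 else 0 : ℕ) : ZMod 2) =
      if ∃ u ∈ m.getLast?, G.Adj u v then 1 else 0 := by
  have hV : 4 ≤ Fintype.card V := by
    have := G.degree_lt_card_verts v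
    have := hcubic v
    omega
  obtain ⟨m, p, u, rfl, hup, hpv⟩ := h.exists_eq_append hV
  have hlast : (∃ z ∈ (m ++ [p, u]).getLast?, G.Adj z v) ↔ G.Adj u v := by simp
  rw [← Finset.card_filter]
  have : (Finset.univ.filter fun x => IsPivot G (m ++ [p, u]) x) =
      ((G.neighborFinset u).erase p).erase v := by
    ext x
    simp [h.isPivot_iff]
    tauto
  have h3 : (G.neighborFinset u).card = 3 := by
    rw [G.card_neighborFinset_eq_degree, ← hcubic u]
  have h2 : ((G.neighborFinset u).erase p).card = 2 := by
    rw [Finset.card_erase_of_mem (by simpa using hup), h3]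
  simp only [hlast]
  rw [this]
  by_cases huv : G.Adj u v
  · rw [Finset.card_erase_of_mem (by simp [huv, hpv.symm]), h2]
    simp [huv]
  · rw [Finset.erase_eq_of_notMem (by simp [huv]), h2]
    simp only [huv, if_false]
    rfl

/-- The number of Hamiltonian paths with given first edge `vw` that close up to a Hamiltonian
cycle is even. -/
lemma even_card_closed_isHamArc [Fintype V]
    (hcubic : ∀ v : V, ∀ [Fintype (G.neighborSet v)], G.degree v = 3) :
    Even {m | IsHamArc G v w m ∧ ∃ u ∈ m.getLast?, G.Adj u v}.ncard := by
  classical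
  set S := (finite_isHamArc (G := G) (v := v) (w := w)).toFinset with hS
  have hmem : ∀ m, m ∈ S ↔ IsHamArc G v w m := by simp [hS]
  have hset : {m | IsHamArc G v w m ∧ ∃ u ∈ m.getLast?, G.Adj u v} =
      (S.filter fun m => ∃ u ∈ m.getLast?, G.Adj u v : Finset (List V)) := by
    ext m
    simp [hmem]
  rw [hset, Set.ncard_coe_finset, ← ZMod.natCast_eq_zero_iff_even, Finset.card_filter,
    Nat.cast_sum]
  have h1 : ∑ m ∈ S, ((if ∃ u ∈ m.getLast?, G.Adj u v then 1 else 0 : ℕ) : ZMod 2) =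
      ∑ m ∈ S, ∑ x : V, if IsPivot G m x then 1 else 0 := by
    refine Finset.sum_congr rfl fun m hm => ?_
    have := ((hmem m).1 hm).card_isPivot (fun v => hcubic v)
    push_cast at this ⊢
    exact this.symm
  rw [h1, ← Finset.sum_product' S Finset.univ (fun m x => if IsPivot G m x then (1 : ZMod 2) else 0),
    ← Finset.sum_filter (fun q : List V × V => IsPivot G q.1 q.2)]
  have hspec : ∀ q ∈ (S ×ˢ Finset.univ).filter (fun q : List V × V => IsPivot G q.1 q.2),
      IsHamArc G v w q.1 ∧ IsPivot G q.1 q.2 := by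
    simp [hmem]
  refine Finset.sum_involution (fun q _ => (reverseAfter q.1 q.2, q.2)) ?_ ?_ ?_ ?_
  · intros; rfl
  · intro q hq _ he
    obtain ⟨h, h'⟩ := hspec q hq
    exact (h.reverseAfter_spec h').2.2.1 (congrArg Prod.fst he)
  · intro q hq
    obtain ⟨h, h'⟩ := hspec q hq
    have := h.reverseAfter_spec h'
    simp [hmem, this.1, this.2.1]
  · intro q hq
    obtain ⟨h, h'⟩ := hspec q hq
    exact Prod.ext (h.reverseAfter_spec h').2.2.2 rfl

lemma IsHamArc.exists_closed_ne [Fintype V] {m : List V}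
    (hcubic : ∀ v : V, ∀ [Fintype (G.neighborSet v)], G.degree v = 3)
    (h : IsHamArc G v w m) (hc : ∃ u ∈ m.getLast?, G.Adj u v) :
    ∃ m', IsHamArc G v w m' ∧ (∃ u ∈ m'.getLast?, G.Adj u v) ∧ m' ≠ m := by
  have hfin : {m | IsHamArc G v w m ∧ ∃ u ∈ m.getLast?, G.Adj u v}.Finite :=
    finite_isHamArc.subset fun _ h => h.1
  have hpos := (Set.ncard_pos hfin).2 ⟨m, h, hc⟩
  obtain ⟨k, hk⟩ := even_card_closed_isHamArc (v := v) (w := w) hcubic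
  obtain ⟨m', hm', hne⟩ := Set.exists_ne_of_one_lt_ncard (show 1 < _ by rw [hk]; omega) m
  exact ⟨m', hm'.1, hm'.2, hne⟩

/-- The neighbours of an inner vertex `y` in the path given by a list in which `y` occurs once. -/
lemma eq_or_eq_of_pair_infix {a b : List V} {x y z z' : V} (h1 : y ∉ a ++ [x])
    (h2 : y ∉ z' :: b) (h : [y, z] <:+: a ++ x :: y :: z' :: b ∨
      [z, y] <:+: a ++ x :: y :: z' :: b) : z = x ∨ z = z' := by
  have e : a ++ x :: y :: z' :: b = (a ++ [x]) ++ y :: (z' :: b) := by simp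
  rw [e] at h
  rcases h with ⟨s, t, h⟩ | ⟨s, t, h⟩
  · have h : s ++ y :: (z :: t) = (a ++ [x]) ++ y :: (z' :: b) := by simpa using h
    have := (List.append_cons_inj_of_notMem h1 h2).1 h.symm
    simp at this
    exact Or.inr this.2.1.symm
  · have h : (s ++ [z]) ++ y :: t = (a ++ [x]) ++ y :: (z' :: b) := by simpa using h
    have := ((List.append_cons_inj_of_notMem h1 h2).1 h.symm).1
    exact Or.inl (by simpa using (List.append_inj' this.symm rfl).2)

/-- A closed path is determined by its first two vertices and its edges. -/
lemma eq_of_pair_infix_imp {q q' : List V} {p : List V} {x y : V}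
    (hq : (p ++ x :: y :: q).Nodup) (hq' : (p ++ x :: y :: q').Nodup) (hv : v ∉ y :: q')
    (hl : q.length = q'.length)
    (hE : ∀ y' z, [y', z] <:+: p ++ x :: y :: (q ++ [v]) →
      [y', z] <:+: p ++ x :: y :: (q' ++ [v]) ∨ [z, y'] <:+: p ++ x :: y :: (q' ++ [v])) :
    q = q' := by
  induction q generalizing q' p x y with
  | nil => exact (List.length_eq_zero_iff.1 hl.symm).symm
  | cons z q ih =>
    match q' with
    | z' :: q' =>
      have hz : z = x ∨ z = z' := by
        refine eq_or_eq_of_pair_infix (y := y) (a := p) (b := q' ++ [v]) ?_ ?_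
          (hE y z ⟨p ++ [x], q ++ [v], by simp⟩)
        · simp [List.nodup_append] at hq'
          grind
        · simp [List.nodup_append] at hq' hv
          grind
      have hzx : z ≠ x := by
        simp [List.nodup_append] at hq
        grind
      obtain rfl := hz.resolve_left hzx
      have := ih (q' := q') (p := p ++ [x]) (x := y) (y := z) (by simpa using hq)
        (by simpa using hq') (fun h => hv (List.mem_cons_of_mem _ h)) (by simpa using hl)
        (by simpa using hE)
      rw [this]

lemma IsHamArc.eq_of_edges_eq [Fintype V] {m m' : List V} (h : IsHamArc G v w m)
    (h' : IsHamArc G v w m') {c c' : G.Walk v v} (hc : c.support = v :: (m ++ [v]))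
    (hc' : c'.support = v :: (m' ++ [v])) (hE : ∀ e, e ∈ c.edges → e ∈ c'.edges) : m = m' := by
  have hn := h.nodup
  have hn' := h'.nodup
  have hl : m.length = m'.length := by
    have := h.length_add_one
    have := h'.length_add_one
    omega
  obtain ⟨t, rfl⟩ := List.head?_eq_some_iff.1 h.head
  obtain ⟨t', rfl⟩ := List.head?_eq_some_iff.1 h'.head
  have : t = t' := by
    refine eq_of_pair_infix_imp (v := v) (p := []) hn hn' (List.nodup_cons.1 hn').1
      (by simpa using hl) fun y z hyz => ?_
    have h1 := hE s(y, z) (Walk.infix_support_iff_mem_edges.1 (Or.inl (by rw [hc]; exact hyz)))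
    have h2 := Walk.infix_support_iff_mem_edges.2 h1
    rw [hc'] at h2
    exact h2
  rw [this]

lemma IsHamArc.exists_isHamiltonianCycle [Fintype V] [DecidableEq V] {m : List V}
    (h : IsHamArc G v w m) (hc : ∃ u ∈ m.getLast?, G.Adj u v) (hV : 4 ≤ Fintype.card V) :
    ∃ c : G.Walk v v, c.IsHamiltonianCycle ∧ c.support = v :: (m ++ [v]) := by
  have hchain : (v :: (m ++ [v])).IsChain G.Adj := by
    rw [← List.cons_append, List.isChain_append]
    refine ⟨h.chain, by simp, ?_⟩
    obtain ⟨u, hu, huv⟩ := hc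
    intro x hx y hy
    have hx : u = x := by
      rw [List.getLast?_cons, Option.mem_def.1 hu] at hx
      simpa using hx
    simp at hy
    rwa [← hx, ← hy]
  obtain ⟨c, hcs⟩ : ∃ c : G.Walk v v, c.support = v :: (m ++ [v]) := by
    have hne := List.cons_ne_nil v (m ++ [v])
    have hhead : (v :: (m ++ [v])).head hne = v := rfl
    have hlast : (v :: (m ++ [v])).getLast hne = v := by simp
    exact ⟨(Walk.ofSupport _ hne hchain).copy hhead hlast, by
      rw [Walk.support_copy, Walk.support_ofSupport]⟩
  have hlen : c.length = Fintype.card V := by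
    have h1 := c.length_support
    rw [hcs] at h1
    have h2 := h.length_add_one
    simp at h1
    omega
  refine ⟨c, Walk.isHamiltonianCycle_iff_isCycle_and_length_eq.2 ⟨?_, hlen⟩, hcs⟩
  refine Walk.isCycle_iff_isPath_tail_and_le_length.2 ⟨Walk.IsPath.mk' ?_, by omega⟩
  have hnil : ¬ c.Nil := by rw [Walk.not_nil_iff_lt_length]; omega
  rw [Walk.support_tail_of_not_nil _ hnil, hcs, List.tail_cons]
  exact (List.perm_append_singleton v m).nodup_iff.2 h.nodup

lemma SimpleGraph.Walk.IsHamiltonianCycle.exists_isHamArc [Fintype V] [DecidableEq V]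
    {c : G.Walk v v} (hc : c.IsHamiltonianCycle) (hw : c.snd = w) :
    ∃ m, IsHamArc G v w m ∧ (∃ u ∈ m.getLast?, G.Adj u v) ∧ c.support = v :: (m ++ [v]) := by
  subst hw
  have hnil := hc.not_nil
  have h3 := hc.isCycle.three_le_length
  have hlen := c.length_support
  obtain ⟨m, hm⟩ : ∃ m, c.support = v :: (m ++ [v]) := by
    refine ⟨c.support.tail.dropLast, ?_⟩
    have h1 := c.cons_tail_support.symm
    have h4 : c.support.tail ≠ [] := by
      intro h
      rw [h] at h1
      rw [h1, List.length_singleton] at hlen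
      omega
    have h5 := List.dropLast_append_getLast h4
    rw [List.getLast_tail] at h5
    simp at h5
    rw [h5]
    exact h1
  have hmlen : 2 ≤ m.length := by
    rw [hm] at hlen
    simp at hlen
    omega
  have htail := Walk.support_tail_of_not_nil c hnil
  rw [hm, List.tail_cons] at htail
  have hperm := List.perm_append_singleton v m
  have hch := c.isChain_adj_support
  rw [hm, ← List.cons_append, List.isChain_append] at hch
  have hne : m ≠ [] := by rintro rfl; simp at hmlen
  refine ⟨m, ⟨?_, ?_, ?_, hch.1⟩, ⟨m.getLast hne, List.getLast?_eq_getLast_of_ne_nil hne, ?_⟩, hm⟩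
  · have h1 := c.tail.cons_tail_support.symm
    rw [htail] at h1
    obtain ⟨a, t, rfl⟩ := List.exists_cons_of_ne_nil hne
    simp at h1
    simp [h1]
  · rw [← hperm.nodup_iff, ← htail]
    exact hc.isHamiltonian_tail.isPath.support_nodup
  · intro y
    rw [← hperm.mem_iff, ← htail]
    exact hc.isHamiltonian_tail.mem_support y
  · refine hch.2.2 _ ?_ v (by simp)
    rw [List.getLast?_cons, List.getLast?_eq_getLast_of_ne_nil hne]
    rfl

/-- An edge of a Hamiltonian cycle is the first edge of a Hamiltonian cycle with the same edges. -/
lemma SimpleGraph.Walk.IsHamiltonianCycle.exists_snd_eq [DecidableEq V] {u : V}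
    {c : G.Walk u u} (hc : c.IsHamiltonianCycle) (h : s(v, w) ∈ c.edges) :
    ∃ c' : G.Walk v v, c'.IsHamiltonianCycle ∧ c'.snd = w ∧ ∀ e, e ∈ c'.edges ↔ e ∈ c.edges := by
  have hv := c.fst_mem_support_of_mem_edges h
  have hrot := (Walk.isHamiltonianCycle_rotate hv).2 hc
  have hedges : ∀ e, e ∈ (c.rotate v hv).edges ↔ e ∈ c.edges :=
    fun e => (c.rotate_edges v hv).mem_iff
  have hw : w ∈ (c.rotate v hv).toSubgraph.neighborSet v := by
    rw [Subgraph.mem_neighborSet, ← Subgraph.mem_edgeSet, Walk.mem_edges_toSubgraph, hedges]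
    exact h
  rw [hrot.isCycle.neighborSet_toSubgraph_endpoint] at hw
  rcases hw with hw | hw
  · exact ⟨_, hrot, hw.symm, hedges⟩
  · have : Finite V := hc.finite
    have := Fintype.ofFinite V
    refine ⟨(c.rotate v hv).reverse, ?_, ?_, fun e => ?_⟩
    · rw [Walk.isHamiltonianCycle_iff_isCycle_and_length_eq] at hrot ⊢
      exact ⟨hrot.1.reverse, by simpa using hrot.2⟩
    · rw [Walk.snd_reverse, hw]
    · rw [Walk.edges_reverse, List.mem_reverse, hedges]

/-- In a cubic graph every edge of a Hamiltonian cycle lies on a second one. -/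
lemma exists_hamSets_ne [Fintype V] [DecidableEq V]
    (hcubic : ∀ v : V, ∀ [Fintype (G.neighborSet v)], G.degree v = 3) {E : Set (Sym2 V)}
    (hE : E ∈ HamSets G) {e : Sym2 V} (he : e ∈ E) : ∃ E' ∈ HamSets G, e ∈ E' ∧ E' ≠ E := by
  classical
  obtain ⟨u, c, hc, rfl⟩ := hE
  induction e with
  | h v w =>
  obtain ⟨c', hc', hsnd, hedges⟩ := hc.exists_snd_eq he
  obtain ⟨m, hm, hcl, hsupp⟩ := hc'.exists_isHamArc hsnd
  obtain ⟨m', hm', hcl', hne⟩ := hm.exists_closed_ne hcubic hcl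
  have hV : 4 ≤ Fintype.card V := by
    have := G.degree_lt_card_verts v
    have := hcubic v
    omega
  obtain ⟨c'', hc'', hsupp'⟩ := hm'.exists_isHamiltonianCycle hcl' hV
  refine ⟨_, ⟨v, c'', hc'', rfl⟩, ?_, fun h => ?_⟩
  · obtain ⟨t, rfl⟩ := List.head?_eq_some_iff.1 hm'.head
    exact Walk.infix_support_iff_mem_edges.1 (Or.inl (by
      rw [hsupp']; exact ⟨[], t ++ [v], by simp⟩))
  · refine hne (hm'.eq_of_edges_eq hm hsupp' hsupp fun e he => ?_)
    rw [hedges]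
    exact (Set.ext_iff.1 h e).1 he

lemma ncard_of_mem_hamSets [Fintype V] [DecidableEq V] {E : Set (Sym2 V)} (hE : E ∈ HamSets G) :
    E.ncard = Fintype.card V := by
  obtain ⟨u, c, hc, rfl⟩ := hE
  rw [← hc.length_eq, ← c.length_edges, ← List.toFinset_card_of_nodup hc.isCycle.edges_nodup,
    ← Set.ncard_coe_finset]
  simp

lemma exists_edge_of_mem_hamSets [Fintype V] [DecidableEq V] {E : Set (Sym2 V)}
    (hE : E ∈ HamSets G) (v : V) : ∃ e ∈ E, v ∈ e := by
  obtain ⟨u, c, hc, rfl⟩ := hE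
  have hs := hc.mem_support v
  have hr := hc.rotate hs
  refine ⟨s(v, (c.rotate v hs).snd), ?_, by simp⟩
  exact (c.rotate_edges v hs).mem_iff.1 (Walk.mk_start_snd_mem_edges hr.not_nil)

end

/-- In a finite cubic graph with a Hamiltonian cycle, some vertex lies on at least three
distinct Hamiltonian cycles; in particular some edge lies on at least two. -/
theorem cubic_vertex_three_ham_cycles
    {V : Type*} [Fintype V] [DecidableEq V] (G : SimpleGraph V) [DecidableRel G.Adj]
    (hcubic : ∀ v : V, G.degree v = 3) (hne : (HamSets G).Nonempty) :
    (∃ v : V, 3 ≤ {E ∈ HamSets G | ∃ e ∈ E, v ∈ e}.ncard) ∧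
    (∃ e ∈ G.edgeSet, 2 ≤ {E ∈ HamSets G | e ∈ E}.ncard) := by
  classical
  have hcubic' : ∀ v : V, ∀ [Fintype (G.neighborSet v)], G.degree v = 3 := by
    intro v _
    rw [← hcubic v]
    congr!
  obtain ⟨E, hE⟩ := hne
  have hv : Nonempty V := let ⟨v, _⟩ := hE; ⟨v⟩
  obtain ⟨v⟩ := hv
  obtain ⟨e, he, -⟩ := exists_edge_of_mem_hamSets hE v
  obtain ⟨E₁, hE₁, he₁, hne₁⟩ := exists_hamSets_ne hcubic' hE he
  obtain ⟨f, hf, hf₁⟩ : ∃ f ∈ E, f ∉ E₁ := by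
    by_contra! hsub
    refine hne₁ (Set.eq_of_subset_of_ncard_le hsub ?_ (Set.toFinite _)).symm
    rw [ncard_of_mem_hamSets hE, ncard_of_mem_hamSets hE₁]
  obtain ⟨E₂, hE₂, hf₂, hne₂⟩ := exists_hamSets_ne hcubic' hE hf
  have hne₁₂ : E₁ ≠ E₂ := by
    rintro rfl
    exact hf₁ hf₂
  refine ⟨⟨v, ?_⟩, e, ?_, ?_⟩
  · rw [← Set.ncard_eq_three.2 ⟨E, E₁, E₂, hne₁.symm, hne₂.symm, hne₁₂, rfl⟩]
    refine Set.ncard_le_ncard ?_ (Set.toFinite _)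
    rintro F (rfl | rfl | rfl)
    exacts [⟨hE, exists_edge_of_mem_hamSets hE v⟩, ⟨hE₁, exists_edge_of_mem_hamSets hE₁ v⟩,
      ⟨hE₂, exists_edge_of_mem_hamSets hE₂ v⟩]
  · obtain ⟨u, c, -, rfl⟩ := hE
    exact c.edges_subset_edgeSet he
  · rw [← Set.ncard_pair hne₁]
    refine Set.ncard_le_ncard ?_ (Set.toFinite _)
    rintro F (rfl | rfl)
    exacts [⟨hE₁, he₁⟩, ⟨hE, he⟩]
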